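/- One has A_2(0) > 0 for every 0 < r < 1/3, and A_2(π) > 0 for every 0 < r < 1. -/

import Mathlib

open Real Filter

/-- The reflection map of the unit circle with light source at `(r,0)`. -/
noncomputable def R (r : ℝ) (φ : ℝ) : ℝ :=
  φ + π - 2 * arctan (r * sin φ / (1 - r * cos φ))

/-- The angle `φ_c ∈ (0,π)` with `cos φ_c = (1 − √(1+8r²))/(4r)`. -/
noncomputable def φc (r : ℝ) : ℝ :=
  arccos ((1 - Real.sqrt (1 + 8 * r ^ 2)) / (4 * r))

/-- `x`-coordinate of the caustic of `R_r^n`. -/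
noncomputable def xc (r : ℝ) (n : ℕ) (φ : ℝ) : ℝ :=
  (deriv ((R r)^[n]) φ * cos φ + cos ((R r)^[n] φ)) / (1 + deriv ((R r)^[n]) φ)

/-- `y`-coordinate of the caustic of `R_r^n`. -/
noncomputable def yc (r : ℝ) (n : ℕ) (φ : ℝ) : ℝ :=
  (deriv ((R r)^[n]) φ * sin φ + sin ((R r)^[n] φ)) / (1 + deriv ((R r)^[n]) φ)

/-- The quantity `A_n(φ) = −(R_r^n)'(φ) + ((R_r^n)'(φ))³ + 2 (R_r^n)'''(φ)`. -/
noncomputable def A (r : ℝ) (n : ℕ) (φ : ℝ) : ℝ :=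
  -(deriv ((R r)^[n]) φ) + (deriv ((R r)^[n]) φ) ^ 3 + 2 * iteratedDeriv 3 ((R r)^[n]) φ

/-- First derivative of the reflection map. -/
noncomputable def R₁ (r φ : ℝ) : ℝ := 2 - (1 - r ^ 2) / (1 - 2 * r * cos φ + r ^ 2)

/-- Second derivative of the reflection map. -/
noncomputable def R₂ (r φ : ℝ) : ℝ :=
  (1 - r ^ 2) * (2 * r * sin φ) / (1 - 2 * r * cos φ + r ^ 2) ^ 2

/-- Third derivative of the reflection map. -/
noncomputable def R₃ (r φ : ℝ) : ℝ :=
  (1 - r ^ 2) * (2 * r * cos φ / (1 - 2 * r * cos φ + r ^ 2) ^ 2 -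
    2 * (2 * r * sin φ) ^ 2 / (1 - 2 * r * cos φ + r ^ 2) ^ 3)

lemma one_sub_mul_cos_pos {r : ℝ} (h0 : 0 < r) (h1 : r < 1) (φ : ℝ) : 0 < 1 - r * cos φ := by
  nlinarith [cos_le_one φ]

lemma sq_dist_pos {r : ℝ} (h0 : 0 < r) (h1 : r < 1) (φ : ℝ) :
    0 < 1 - 2 * r * cos φ + r ^ 2 := by
  nlinarith [cos_le_one φ, mul_pos (sub_pos.2 h1) (sub_pos.2 h1)]

lemma hasDerivAt_sq_dist (r φ : ℝ) :
    HasDerivAt (fun φ => 1 - 2 * r * cos φ + r ^ 2) (2 * r * sin φ) φ := by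
  have h : HasDerivAt (fun φ => 1 - 2 * r * cos φ + r ^ 2) _ φ :=
    (((hasDerivAt_cos φ).const_mul (2 * r)).const_sub 1).add_const (r ^ 2)
  convert h using 1
  ring

lemma hasDerivAt_R {r : ℝ} (h0 : 0 < r) (h1 : r < 1) (φ : ℝ) :
    HasDerivAt (R r) (R₁ r φ) φ := by
  have hp := one_sub_mul_cos_pos h0 h1 φ
  have hD := sq_dist_pos h0 h1 φ
  have hq : HasDerivAt (fun φ => r * sin φ / (1 - r * cos φ)) _ φ :=
    ((hasDerivAt_sin φ).const_mul r).div (((hasDerivAt_cos φ).const_mul r).const_sub 1) hp.ne'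
  have h : HasDerivAt (R r) _ φ :=
    ((hasDerivAt_id φ).add_const π).sub (hq.arctan.const_mul 2)
  convert h using 1
  have hs : sin φ ^ 2 = 1 - cos φ ^ 2 := sin_sq φ
  have hsum : 1 + (r * sin φ / (1 - r * cos φ)) ^ 2 =
      (1 - 2 * r * cos φ + r ^ 2) / (1 - r * cos φ) ^ 2 := by
    field_simp
    linear_combination r ^ 2 * hs
  rw [hsum, R₁]
  field_simp
  linear_combination (-2 * r ^ 2) * hs

lemma hasDerivAt_R₁ {r : ℝ} (h0 : 0 < r) (h1 : r < 1) (φ : ℝ) :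
    HasDerivAt (R₁ r) (R₂ r φ) φ := by
  have hD := sq_dist_pos h0 h1 φ
  have h : HasDerivAt (R₁ r) _ φ :=
    ((hasDerivAt_const φ (1 - r ^ 2)).div (hasDerivAt_sq_dist r φ) hD.ne').const_sub 2
  convert h using 1
  rw [R₂]
  ring

lemma hasDerivAt_R₂ {r : ℝ} (h0 : 0 < r) (h1 : r < 1) (φ : ℝ) :
    HasDerivAt (R₂ r) (R₃ r φ) φ := by
  have hD := sq_dist_pos h0 h1 φ
  have h : HasDerivAt (R₂ r) _ φ :=
    (((hasDerivAt_sin φ).const_mul (2 * r)).const_mul (1 - r ^ 2)).div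
      ((hasDerivAt_sq_dist r φ).pow 2) (pow_ne_zero 2 hD.ne')
  convert h using 1
  rw [R₃]
  have hD' := hD.ne'
  generalize 1 - 2 * r * cos φ + r ^ 2 = D at hD' ⊢
  push_cast
  field_simp

/-- The chain rule up to third order for a function composed with itself. -/
lemma deriv_and_iteratedDeriv_three_iterate_two {f f₁ f₂ f₃ : ℝ → ℝ}
    (hf : ∀ x, HasDerivAt f (f₁ x) x) (hf₁ : ∀ x, HasDerivAt f₁ (f₂ x) x)
    (hf₂ : ∀ x, HasDerivAt f₂ (f₃ x) x) (x : ℝ) :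
    deriv (f^[2]) x = f₁ (f x) * f₁ x ∧
    iteratedDeriv 3 (f^[2]) x =
      f₃ (f x) * f₁ x ^ 3 + 3 * f₂ (f x) * f₁ x * f₂ x + f₁ (f x) * f₃ x := by
  have e₁ : deriv (f^[2]) = fun x => f₁ (f x) * f₁ x :=
    funext fun x => ((hf (f x)).comp x (hf x)).deriv
  have e₂ : deriv (fun x => f₁ (f x) * f₁ x) =
      fun x => f₂ (f x) * f₁ x * f₁ x + f₁ (f x) * f₂ x :=
    funext fun x => (((hf₁ (f x)).comp x (hf x)).mul (hf₁ x)).deriv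
  have e₃ : HasDerivAt (fun x => f₂ (f x) * f₁ x * f₁ x + f₁ (f x) * f₂ x) _ x :=
    ((((hf₂ (f x)).comp x (hf x)).mul (hf₁ x)).mul (hf₁ x)).add
      (((hf₁ (f x)).comp x (hf x)).mul (hf₂ x))
  refine ⟨congrFun e₁ x, ?_⟩
  rw [iteratedDeriv_succ, iteratedDeriv_succ, iteratedDeriv_one, e₁, e₂, e₃.deriv]
  simp only [Function.comp_apply, Pi.mul_apply]
  ring

lemma A_two_eq {r : ℝ} (h0 : 0 < r) (h1 : r < 1) (φ : ℝ) :
    A r 2 φ = -(R₁ r (R r φ) * R₁ r φ) + (R₁ r (R r φ) * R₁ r φ) ^ 3 +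
      2 * (R₃ r (R r φ) * R₁ r φ ^ 3 + 3 * R₂ r (R r φ) * R₁ r φ * R₂ r φ +
        R₁ r (R r φ) * R₃ r φ) := by
  obtain ⟨e₁, e₃⟩ := deriv_and_iteratedDeriv_three_iterate_two
    (hasDerivAt_R h0 h1) (hasDerivAt_R₁ h0 h1) (hasDerivAt_R₂ h0 h1) φ
  rw [A, e₁, e₃]

lemma A_two_zero {r : ℝ} (h0 : 0 < r) (h1 : r < 1) :
    A r 2 0 = r ^ 2 * (48 - 96 * r + 480 * r ^ 2 - 96 * r ^ 3 - 720 * r ^ 4) /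
      (1 - r ^ 2) ^ 3 := by
  have hm : 1 - r ≠ 0 := by linarith
  have hp : 1 + r ≠ 0 := by linarith
  have dm : 1 - 2 * r + r ^ 2 = (1 - r) ^ 2 := by ring
  have dp : 1 + 2 * r + r ^ 2 = (1 + r) ^ 2 := by ring
  have d : 1 - r ^ 2 = (1 - r) * (1 + r) := by ring
  have hR : R r 0 = π := by simp [R]
  rw [A_two_eq h0 h1, hR]
  simp only [R₁, R₂, R₃, cos_zero, sin_zero, cos_pi, sin_pi, mul_one, mul_neg, sub_neg_eq_add,
    dm, dp, d]
  field_simp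
  ring

lemma A_two_pi {r : ℝ} (h0 : 0 < r) (h1 : r < 1) :
    A r 2 π = r ^ 2 * (48 + 96 * r + 480 * r ^ 2 + 96 * r ^ 3 - 720 * r ^ 4) /
      (1 - r ^ 2) ^ 3 := by
  have hm : 1 - r ≠ 0 := by linarith
  have hp : 1 + r ≠ 0 := by linarith
  have dm : 1 - 2 * r + r ^ 2 = (1 - r) ^ 2 := by ring
  have dp : 1 + 2 * r + r ^ 2 = (1 + r) ^ 2 := by ring
  have d : 1 - r ^ 2 = (1 - r) * (1 + r) := by ring
  have hR : R r π = 2 * π := by simp [R]; ring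
  rw [A_two_eq h0 h1, hR]
  simp only [R₁, R₂, R₃, cos_two_pi, sin_two_pi, cos_pi, sin_pi, mul_one, mul_neg,
    sub_neg_eq_add, dm, dp, d]
  field_simp
  ring

theorem stmt_9 :
    (∀ r : ℝ, 0 < r → r < 1 / 3 → 0 < A r 2 0) ∧
    (∀ r : ℝ, 0 < r → r < 1 → 0 < A r 2 π) := by
  constructor
  · intro r h0 h3
    have h1 : r < 1 := by linarith
    have hd : 0 < 1 - r ^ 2 := by nlinarith
    have h2 : r ^ 2 < 1 / 9 := by nlinarith
    have h3' : r ^ 3 < 1 / 27 := by nlinarith [pow_pos h0 2]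
    have h4 : r ^ 4 ≤ r ^ 2 / 9 := by nlinarith [pow_pos h0 2]
    have : 0 < 48 - 96 * r + 480 * r ^ 2 - 96 * r ^ 3 - 720 * r ^ 4 := by
      nlinarith [sq_nonneg (r - 1 / 8), pow_pos h0 2]
    rw [A_two_zero h0 h1]
    positivity
  · intro r h0 h1
    have hd : 0 < 1 - r ^ 2 := by nlinarith
    have h2 : r ^ 2 < 1 := by linarith
    have h4 : r ^ 4 < 1 := pow_lt_one₀ h0.le h1 (by norm_num)
    have h41 : r ^ 4 < r := by simpa using pow_lt_pow_right_of_lt_one₀ h0 h1 (show 1 < 4 by norm_num)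
    have h42 : r ^ 4 < r ^ 2 := pow_lt_pow_right_of_lt_one₀ h0 h1 (by norm_num)
    have h43 : r ^ 4 < r ^ 3 := pow_lt_pow_right_of_lt_one₀ h0 h1 (by norm_num)
    have : 0 < 48 + 96 * r + 480 * r ^ 2 + 96 * r ^ 3 - 720 * r ^ 4 := by linarith
    rw [A_two_pi h0 h1]
    positivity
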